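/- arXiv:2107.05770 — 2 statements merged into one kernel-verified Lean document; each statement's English description precedes it below -/
import Mathlib

section
/- Let Ω = [B₋, B₊] be split at an interior point x_I ∈ (B₋, B₊) into Ω₋ = [B₋, x_I] and Ω₊ = [x_I, B₊]. Let a, b ∈ ℝ be constants with b > 0 and c := b − a² > 0, and let u⁻ on Ω₋ × [0,∞) and u⁺ on Ω₊ × [0,∞) be twice continuously differentiable solutions of the shifted wave equation ∂t(∂t u − a ∂x u) − ∂x(a(∂t u − a ∂x u) + b ∂x u) = 0 on their respective subdomains. Assume the interface conditions ∂t u⁻(x_I, t) = ∂t u⁺(x_I, t) and ∂x u⁻(x_I, t) = ∂x u⁺(x_I, t) for all t ≥ 0, and assume the external boundary contributions vanish: [∂t u⁻ · (a ∂t u⁻ + c ∂x u⁻)](B₋, t) = 0 and [∂t u⁺ · (a ∂t u⁺ + c ∂x u⁺)](B₊, t) = 0 for all t ≥ 0. Then E_c(t) := E_c⁻(t) + E_c⁺(t) is constant in time, where E_c^±(t) = ∫_{Ω_±} (∂t u^±)² dx + c ∫_{Ω_±} (∂x u^±)² dx; that is, d/dt E_c(t) = 0. -/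
open MeasureTheory

/-- Partial derivative in time of `u : ℝ → ℝ → ℝ` (first argument is space). -/
noncomputable def pdt (u : ℝ → ℝ → ℝ) (x t : ℝ) : ℝ := deriv (fun s => u x s) t

/-- Partial derivative in space of `u : ℝ → ℝ → ℝ` (first argument is space). -/
noncomputable def pdx (u : ℝ → ℝ → ℝ) (x t : ℝ) : ℝ := deriv (fun y => u y t) x

section

open Set

lemma pdt_eq_fderiv {u : ℝ → ℝ → ℝ} {x t : ℝ}
    (hu : DifferentiableAt ℝ (fun p : ℝ × ℝ => u p.1 p.2) (x, t)) :
    pdt u x t = fderiv ℝ (fun p : ℝ × ℝ => u p.1 p.2) (x, t) (0, 1) :=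
  (hu.hasFDerivAt.comp_hasDerivAt (f := fun s => (x, s)) t
    ((hasDerivAt_const t x).prodMk (hasDerivAt_id t))).deriv

lemma pdx_eq_fderiv {u : ℝ → ℝ → ℝ} {x t : ℝ}
    (hu : DifferentiableAt ℝ (fun p : ℝ × ℝ => u p.1 p.2) (x, t)) :
    pdx u x t = fderiv ℝ (fun p : ℝ × ℝ => u p.1 p.2) (x, t) (1, 0) :=
  (hu.hasFDerivAt.comp_hasDerivAt (f := fun y => (y, t)) x
    ((hasDerivAt_id x).prodMk (hasDerivAt_const x t))).deriv

lemma hasDerivAt_pdt {u : ℝ → ℝ → ℝ} (hu : Differentiable ℝ (fun p : ℝ × ℝ => u p.1 p.2))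
    (x t : ℝ) : HasDerivAt (fun s => u x s) (pdt u x t) t :=
  (hu.comp ((differentiable_const x).prodMk differentiable_id) t).hasDerivAt

lemma hasDerivAt_pdx {u : ℝ → ℝ → ℝ} (hu : Differentiable ℝ (fun p : ℝ × ℝ => u p.1 p.2))
    (x t : ℝ) : HasDerivAt (fun y => u y t) (pdx u x t) x :=
  (hu.comp (differentiable_id.prodMk (differentiable_const t)) x).hasDerivAt

lemma uncurry_pdt_eq {u : ℝ → ℝ → ℝ} (hu : Differentiable ℝ (fun p : ℝ × ℝ => u p.1 p.2)) :
    (fun p : ℝ × ℝ => pdt u p.1 p.2) =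
      fun p => fderiv ℝ (fun p : ℝ × ℝ => u p.1 p.2) p (0, 1) :=
  funext fun p => pdt_eq_fderiv (hu p)

lemma uncurry_pdx_eq {u : ℝ → ℝ → ℝ} (hu : Differentiable ℝ (fun p : ℝ × ℝ => u p.1 p.2)) :
    (fun p : ℝ × ℝ => pdx u p.1 p.2) =
      fun p => fderiv ℝ (fun p : ℝ × ℝ => u p.1 p.2) p (1, 0) :=
  funext fun p => pdx_eq_fderiv (hu p)

lemma contDiff_pdt {u : ℝ → ℝ → ℝ} {m n : WithTop ℕ∞}
    (hu : ContDiff ℝ n (fun p : ℝ × ℝ => u p.1 p.2)) (hmn : m + 1 ≤ n) :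
    ContDiff ℝ m (fun p : ℝ × ℝ => pdt u p.1 p.2) := by
  rw [uncurry_pdt_eq (hu.differentiable fun h => by simp [h] at hmn)]
  exact (hu.fderiv_right hmn).clm_apply contDiff_const

lemma contDiff_pdx {u : ℝ → ℝ → ℝ} {m n : WithTop ℕ∞}
    (hu : ContDiff ℝ n (fun p : ℝ × ℝ => u p.1 p.2)) (hmn : m + 1 ≤ n) :
    ContDiff ℝ m (fun p : ℝ × ℝ => pdx u p.1 p.2) := by
  rw [uncurry_pdx_eq (hu.differentiable fun h => by simp [h] at hmn)]
  exact (hu.fderiv_right hmn).clm_apply contDiff_const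

lemma pdx_pdt_comm {u : ℝ → ℝ → ℝ} (hu : ContDiff ℝ 2 (fun p : ℝ × ℝ => u p.1 p.2))
    (x t : ℝ) : pdx (pdt u) x t = pdt (pdx u) x t := by
  have h1 : (1 : WithTop ℕ∞) + 1 ≤ 2 := by norm_num
  have hd : Differentiable ℝ (fun p : ℝ × ℝ => u p.1 p.2) := hu.differentiable two_ne_zero
  have hd2 : DifferentiableAt ℝ (fderiv ℝ fun p : ℝ × ℝ => u p.1 p.2) (x, t) :=
    (hu.fderiv_right h1).differentiable one_ne_zero _
  rw [pdx_eq_fderiv ((contDiff_pdt hu h1).differentiable one_ne_zero _),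
    pdt_eq_fderiv ((contDiff_pdx hu h1).differentiable one_ne_zero _),
    uncurry_pdt_eq hd, uncurry_pdx_eq hd,
    fderiv_clm_apply hd2 (differentiableAt_const _),
    fderiv_clm_apply hd2 (differentiableAt_const _)]
  simpa using (hu.contDiffAt.isSymmSndFDerivAt (by simp)).eq (1, 0) (0, 1)

/-- Differentiation under the integral sign for a `C¹` integrand on a compact interval. -/
lemma hasDerivAt_integral_of_contDiff {g : ℝ → ℝ → ℝ}
    (hg : ContDiff ℝ 1 (fun p : ℝ × ℝ => g p.1 p.2)) (A B t : ℝ) :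
    HasDerivAt (fun s => ∫ x in A..B, g x s) (∫ x in A..B, pdt g x t) t := by
  have hcont (s : ℝ) : Continuous fun x => g x s :=
    hg.continuous.comp (continuous_id.prodMk continuous_const)
  have hpdt : Continuous fun p : ℝ × ℝ => pdt g p.1 p.2 :=
    (contDiff_pdt (m := 0) hg (by norm_num)).continuous
  obtain ⟨C, hC⟩ := ((isCompact_uIcc (a := A) (b := B)).prod
    (isCompact_Icc (a := t - 1) (b := t + 1))).exists_bound_of_continuousOn hpdt.continuousOn
  exact (intervalIntegral.hasDerivAt_integral_of_dominated_loc_of_deriv_le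
    (F := fun s x => g x s) (F' := fun s x => pdt g x s) (bound := fun _ => C)
    (Icc_mem_nhds (by linarith) (by linarith))
    (.of_forall fun s => (hcont s).aestronglyMeasurable)
    ((hcont t).intervalIntegrable _ _)
    (hpdt.comp (continuous_id.prodMk continuous_const)).aestronglyMeasurable
    (.of_forall fun x hx s hs => hC (x, s) ⟨uIoc_subset_uIcc hx, hs⟩)
    intervalIntegrable_const
    (.of_forall fun x _ s _ => hasDerivAt_pdt (hg.differentiable one_ne_zero) x s)).2

/-- Energy balance on one subdomain: the energy changes only through the boundary flux. -/
lemma hasDerivAt_energy {u : ℝ → ℝ → ℝ} (hu : ContDiff ℝ 2 (fun p : ℝ × ℝ => u p.1 p.2))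
    {A B a b t : ℝ} (hAB : A ≤ B)
    (hpde : ∀ x ∈ Icc A B,
      deriv (fun s => pdt u x s - a * pdx u x s) t
        - deriv (fun y => a * (pdt u y t - a * pdx u y t) + b * pdx u y t) x = 0) :
    HasDerivAt (fun s => (∫ x in A..B, (pdt u x s) ^ 2)
        + (b - a ^ 2) * ∫ x in A..B, (pdx u x s) ^ 2)
      (2 * (pdt u B t * (a * pdt u B t + (b - a ^ 2) * pdx u B t))
        - 2 * (pdt u A t * (a * pdt u A t + (b - a ^ 2) * pdx u A t))) t := by
  have hT := contDiff_pdt (m := 1) hu (by norm_num)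
  have hX := contDiff_pdx (m := 1) hu (by norm_num)
  have dT := hT.differentiable one_ne_zero
  have dX := hX.differentiable one_ne_zero
  have cts {g : ℝ → ℝ → ℝ} (hg : ContDiff ℝ 1 (fun p : ℝ × ℝ => g p.1 p.2)) :
      Continuous (fun x => pdt g x t) ∧ Continuous (fun x => pdx g x t) ∧
        Continuous (fun x => g x t) :=
    ⟨(contDiff_pdt (m := 0) hg (by norm_num)).continuous.comp
        (continuous_id.prodMk continuous_const),
      (contDiff_pdx (m := 0) hg (by norm_num)).continuous.comp
        (continuous_id.prodMk continuous_const),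
      hg.continuous.comp (continuous_id.prodMk continuous_const)⟩
  obtain ⟨cTt, cTx, cT⟩ := cts hT
  obtain ⟨cXt, cXx, cX⟩ := cts hX
  have hsq {g : ℝ → ℝ → ℝ} (hg : Differentiable ℝ (fun p : ℝ × ℝ => g p.1 p.2)) (x : ℝ) :
      pdt (fun x s => g x s ^ 2) x t = 2 * g x t * pdt g x t := by
    simpa [pdt] using ((hasDerivAt_pdt hg x t).fun_pow 2).deriv
  refine ((hasDerivAt_integral_of_contDiff (g := fun x s => pdt u x s ^ 2) (hT.pow 2) A B t).fun_add
    ((hasDerivAt_integral_of_contDiff (g := fun x s => pdx u x s ^ 2) (hX.pow 2) A B t).const_mul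
      (b - a ^ 2))).congr_deriv ?_
  simp only [hsq dT, hsq dX]
  rw [← intervalIntegral.integral_const_mul, ← intervalIntegral.integral_add
    (by apply Continuous.intervalIntegrable; fun_prop)
    (by apply Continuous.intervalIntegrable; fun_prop)]
  have hflux (x : ℝ) := (((hasDerivAt_pdx dT x t).fun_mul
    (((hasDerivAt_pdx dT x t).const_mul a).fun_add
      ((hasDerivAt_pdx dX x t).const_mul (b - a ^ 2)))).const_mul 2)
  rw [← intervalIntegral.integral_eq_sub_of_hasDerivAt (fun x _ => hflux x)
    (by apply Continuous.intervalIntegrable; fun_prop)]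
  refine intervalIntegral.integral_congr fun x hx => ?_
  rw [uIcc_of_le hAB] at hx
  have hwave := hpde x hx
  rw [((hasDerivAt_pdt dT x t).fun_sub ((hasDerivAt_pdt dX x t).const_mul a)).deriv,
    ((((hasDerivAt_pdx dT x t).fun_sub ((hasDerivAt_pdx dX x t).const_mul a)).const_mul a).fun_add
      ((hasDerivAt_pdx dX x t).const_mul b)).deriv] at hwave
  have hcomm := pdx_pdt_comm hu x t
  rw [← hcomm] at hwave ⊢
  linear_combination 2 * pdt u x t * hwave

end

/-- two-domain conservation of the energy `E_c` for constant
coefficients with `c = b − a² > 0`: `d/dt E_c = 0`. -/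
theorem two_domain_energy_conserved_c_pos
    (Bm Bp xI : ℝ) (hI : xI ∈ Set.Ioo Bm Bp)
    (a b : ℝ) (hb : 0 < b) (hc : 0 < b - a ^ 2)
    (um up : ℝ → ℝ → ℝ)
    (hum : ContDiff ℝ 2 (fun p : ℝ × ℝ => um p.1 p.2))
    (hup : ContDiff ℝ 2 (fun p : ℝ × ℝ => up p.1 p.2))
    (hpdem : ∀ x ∈ Set.Icc Bm xI, ∀ t : ℝ, 0 ≤ t →
      deriv (fun s => pdt um x s - a * pdx um x s) t
        - deriv (fun y => a * (pdt um y t - a * pdx um y t) + b * pdx um y t) x = 0)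
    (hpdep : ∀ x ∈ Set.Icc xI Bp, ∀ t : ℝ, 0 ≤ t →
      deriv (fun s => pdt up x s - a * pdx up x s) t
        - deriv (fun y => a * (pdt up y t - a * pdx up y t) + b * pdx up y t) x = 0)
    (hint1 : ∀ t : ℝ, 0 ≤ t → pdt um xI t = pdt up xI t)
    (hint2 : ∀ t : ℝ, 0 ≤ t → pdx um xI t = pdx up xI t)
    (hbdm : ∀ t : ℝ, 0 ≤ t →
      pdt um Bm t * (a * pdt um Bm t + (b - a ^ 2) * pdx um Bm t) = 0)
    (hbdp : ∀ t : ℝ, 0 ≤ t →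
      pdt up Bp t * (a * pdt up Bp t + (b - a ^ 2) * pdx up Bp t) = 0)
    (E : ℝ → ℝ)
    (hE : E = fun t =>
      ((∫ x in Bm..xI, (pdt um x t) ^ 2)
        + (b - a ^ 2) * ∫ x in Bm..xI, (pdx um x t) ^ 2)
      + ((∫ x in xI..Bp, (pdt up x t) ^ 2)
        + (b - a ^ 2) * ∫ x in xI..Bp, (pdx up x t) ^ 2)) :
    ∀ t : ℝ, 0 ≤ t → deriv E t = 0 := by
  intro t ht
  subst hE
  have hm := hasDerivAt_energy hum hI.1.le fun x hx => hpdem x hx t ht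
  have hp := hasDerivAt_energy hup hI.2.le fun x hx => hpdep x hx t ht
  rw [(hm.fun_add hp).deriv, hbdm t ht, hbdp t ht, hint1 t ht, hint2 t ht]
  ring
end

section
/- Let m ≥ 1, let 𝐇 ∈ ℝ^{m×m} be diagonal with positive diagonal entries, and let D̃ ∈ ℝ^{m×m} satisfy 𝐇D̃ + D̃ᵀ𝐇 = 0 (the penalized SBP operator with periodic/no external boundary contributions). Let 𝐚 and 𝐜 be diagonal m×m matrices where the diagonal entries of 𝐜 are positive (c = b − a² > 0 evaluated at the nodes). If U, W : ℝ → ℝᵐ are differentiable and satisfy U′(t) = W(t) and W′(t) = 𝐚D̃W(t) + D̃(𝐚W(t)) − 𝐇⁻¹D̃ᵀ𝐜𝐇D̃ U(t) for all t, then the discrete energy ℰ_c(t) := W(t)ᵀ𝐇W(t) + U(t)ᵀD̃ᵀ𝐜𝐇D̃U(t) is nonnegative and constant in time: d/dt ℰ_c(t) = 0. -/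
open Matrix

section QuadraticForms

variable {n : Type*} [Fintype n]

/-- The derivative of the quadratic form of a symmetric matrix along a curve. -/
theorem hasDerivAt_dotProduct_mulVec_self {M : Matrix n n ℝ} (hM : Mᵀ = M)
    {x : ℝ → n → ℝ} {x' : n → ℝ} {t : ℝ} (hx : HasDerivAt x x' t) :
    HasDerivAt (fun s => x s ⬝ᵥ (M *ᵥ x s)) (2 * (x t ⬝ᵥ (M *ᵥ x'))) t := by
  have hcoord := hasDerivAt_pi.1 hx
  have hMx : ∀ i, HasDerivAt (fun s => (M *ᵥ x s) i) ((M *ᵥ x') i) t := fun i =>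
    HasDerivAt.fun_sum fun j _ => (hcoord j).const_mul (M i j)
  have hform : HasDerivAt (fun s => x s ⬝ᵥ (M *ᵥ x s))
      (∑ i, (x' i * (M *ᵥ x t) i + x t i * (M *ᵥ x') i)) t :=
    HasDerivAt.fun_sum fun i _ => (hcoord i).mul (hMx i)
  convert hform using 1
  rw [Finset.sum_add_distrib]
  change _ = x' ⬝ᵥ (M *ᵥ x t) + x t ⬝ᵥ (M *ᵥ x')
  have hsymm : x' ⬝ᵥ (M *ᵥ x t) = x t ⬝ᵥ (M *ᵥ x') := by
    rw [dotProduct_mulVec, ← mulVec_transpose, hM, dotProduct_comm]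
  rw [hsymm, two_mul]

/-- The quadratic form of a skew-symmetric matrix vanishes. -/
theorem dotProduct_mulVec_self_eq_zero_of_transpose_eq_neg {M : Matrix n n ℝ} (hM : Mᵀ = -M)
    (x : n → ℝ) : x ⬝ᵥ (M *ᵥ x) = 0 := by
  have h : x ⬝ᵥ (M *ᵥ x) = -(x ⬝ᵥ (M *ᵥ x)) := by
    conv_lhs => rw [dotProduct_mulVec, ← mulVec_transpose, hM, dotProduct_comm]
    rw [neg_mulVec, dotProduct_neg]
  linarith

theorem dotProduct_diagonal_mulVec_self_nonneg [DecidableEq n] {d : n → ℝ} (hd : ∀ i, 0 ≤ d i)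
    (x : n → ℝ) : 0 ≤ x ⬝ᵥ (diagonal d *ᵥ x) := by
  refine Finset.sum_nonneg fun i _ => ?_
  rw [mulVec_diagonal]
  nlinarith [mul_nonneg (hd i) (mul_self_nonneg (x i))]

end QuadraticForms

/-- discrete energy conservation in the subsonic regime
(`c = b − a² > 0` at the nodes): `ℰ_c(t) = ⟨W,W⟩_𝐇 + Uᵀ D̃ᵀ𝐜𝐇D̃ U` is
nonnegative and constant in time. -/
theorem discrete_energy_conservation_c (m : ℕ)
    (d : Fin (m + 1) → ℝ) (hd : ∀ i, 0 < d i)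
    (Dt : Matrix (Fin (m + 1)) (Fin (m + 1)) ℝ)
    (hanti : diagonal d * Dt + Dtᵀ * diagonal d = 0)
    (da dc : Fin (m + 1) → ℝ) (hc : ∀ i, 0 < dc i)
    (U W : ℝ → Fin (m + 1) → ℝ)
    (hU : ∀ t : ℝ, HasDerivAt U (W t) t)
    (hW : ∀ t : ℝ, HasDerivAt W
      (diagonal da *ᵥ (Dt *ᵥ W t) + Dt *ᵥ (diagonal da *ᵥ W t)
        - (diagonal d)⁻¹ *ᵥ ((Dtᵀ * diagonal dc * diagonal d * Dt) *ᵥ U t)) t)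
    (E : ℝ → ℝ)
    (hE : E = fun t => W t ⬝ᵥ (diagonal d *ᵥ W t)
        + U t ⬝ᵥ ((Dtᵀ * diagonal dc * diagonal d * Dt) *ᵥ U t)) :
    (∀ t : ℝ, 0 ≤ E t) ∧ ∀ t : ℝ, deriv E t = 0 := by
  have hcomm : ∀ e : Fin (m + 1) → ℝ, diagonal e * diagonal d = diagonal d * diagonal e :=
    fun e => by simp only [diagonal_mul_diagonal, mul_comm]
  set K := Dtᵀ * diagonal dc * diagonal d * Dt with hK
  have hKsymm : Kᵀ = K := by
    simp only [hK, transpose_mul, transpose_transpose, diagonal_transpose]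
    rw [← Matrix.mul_assoc (diagonal d), ← hcomm dc]
    simp only [Matrix.mul_assoc]
  have hunit : IsUnit (diagonal d).det := by
    rw [det_diagonal]
    exact (Finset.prod_pos fun i _ => hd i).ne'.isUnit
  have hskew : (diagonal d * diagonal da * Dt + diagonal d * Dt * diagonal da)ᵀ
      = -(diagonal d * diagonal da * Dt + diagonal d * Dt * diagonal da) := by
    have hDt : Dtᵀ * diagonal d = -(diagonal d * Dt) := eq_neg_of_add_eq_zero_right hanti
    simp only [transpose_add, transpose_mul, diagonal_transpose]
    rw [hcomm da, ← Matrix.mul_assoc, hDt, Matrix.neg_mul, Matrix.mul_neg,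
      ← Matrix.mul_assoc, hcomm da, neg_add]
    abel
  subst hE
  refine ⟨fun t => add_nonneg
    (dotProduct_diagonal_mulVec_self_nonneg (fun i => (hd i).le) _) ?_, fun t => ?_⟩
  · have hKform : U t ⬝ᵥ (K *ᵥ U t)
        = (Dt *ᵥ U t) ⬝ᵥ (diagonal (fun i => dc i * d i) *ᵥ (Dt *ᵥ U t)) := by
      rw [hK, ← diagonal_mul_diagonal, Matrix.mul_assoc, Matrix.mul_assoc, ← mulVec_mulVec,
        dotProduct_mulVec, vecMul_transpose]
      simp only [mulVec_mulVec, Matrix.mul_assoc]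
    rw [hKform]
    exact dotProduct_diagonal_mulVec_self_nonneg (fun i => (mul_pos (hc i) (hd i)).le) _
  · have hderiv := (hasDerivAt_dotProduct_mulVec_self (diagonal_transpose d) (hW t)).add
      (hasDerivAt_dotProduct_mulVec_self hKsymm (hU t))
    refine hderiv.deriv.trans ?_
    have hHW : diagonal d *ᵥ (diagonal da *ᵥ (Dt *ᵥ W t) + Dt *ᵥ (diagonal da *ᵥ W t)
        - (diagonal d)⁻¹ *ᵥ (K *ᵥ U t))
        = (diagonal d * diagonal da * Dt + diagonal d * Dt * diagonal da) *ᵥ W t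
          - K *ᵥ U t := by
      rw [mulVec_sub, mulVec_add, mulVec_mulVec (K *ᵥ U t), mul_nonsing_inv _ hunit, one_mulVec,
        add_mulVec]
      simp only [mulVec_mulVec, Matrix.mul_assoc]
    have hUW : U t ⬝ᵥ (K *ᵥ W t) = W t ⬝ᵥ (K *ᵥ U t) := by
      rw [dotProduct_mulVec, ← mulVec_transpose, hKsymm, dotProduct_comm]
    rw [hHW, dotProduct_sub, dotProduct_mulVec_self_eq_zero_of_transpose_eq_neg hskew, hUW]
    ring
end
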